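/- Height bound for optimal alphabetic trees: let T be an optimal alphabetic tree on weights a_1,…,a_n with every a_i ≥ m for some m > 0, and let h be the height of T (the maximum depth of a leaf). Then m·2^{⌊h/3⌋} ≤ Σ_{i=1}^n a_i. In particular, if all weights are positive integers, then 2^{⌊h/3⌋} ≤ Σ_i a_i, so h ≤ 3·log₂(Σ_i a_i); thus for positive integer weights of word size W the OAT height is O(log W + log n). -/

import Mathlib

/-- Binary trees in which every internal node has exactly two children and
every leaf carries a nonnegative real weight. -/
inductive WTree : Type
  | leaf : ℝ → WTree
  | node : WTree → WTree → WTree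

namespace WTree

/-- The weights of the leaves in left-to-right order. -/
def leaves : WTree → List ℝ
  | leaf x => [x]
  | node l r => leaves l ++ leaves r

/-- The total weight of the leaves of a tree. -/
def wt (t : WTree) : ℝ := t.leaves.sum

/-- The cost `Σ aᵢ dᵢ` of an alphabetic tree (each leaf weight times its
depth), computed recursively. -/
def cost : WTree → ℝ
  | leaf _ => 0
  | node l r => cost l + cost r + wt l + wt r

/-- `t` is an optimal alphabetic tree: it minimizes cost among all alphabetic
trees on the same left-to-right sequence of leaf weights. -/
def IsOAT (t : WTree) : Prop :=
  ∀ t' : WTree, t'.leaves = t.leaves → cost t ≤ cost t'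

/-- `IsSubtree s t`: `s` occurs as (the subtree rooted at) a node of `t`. -/
inductive IsSubtree : WTree → WTree → Prop
  | refl (t : WTree) : IsSubtree t t
  | left {s l r : WTree} : IsSubtree s l → IsSubtree s (node l r)
  | right {s l r : WTree} : IsSubtree s r → IsSubtree s (node l r)

end WTree

/-- The height of the tree: the maximum depth of a leaf (root has depth 0). -/
def WTree.height : WTree → ℕ
  | WTree.leaf _ => 0
  | WTree.node l r => max l.height r.height + 1

namespace WTree

@[simp] theorem wt_node (l r : WTree) : (node l r).wt = l.wt + r.wt := by
  simp [wt, leaves]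

theorem leaves_ne_nil : ∀ t : WTree, t.leaves ≠ []
  | leaf _ => by simp [leaves]
  | node l _ => by simp [leaves, leaves_ne_nil l]

theorem wt_nonneg {t : WTree} (h : ∀ x ∈ t.leaves, 0 ≤ x) : 0 ≤ t.wt :=
  List.sum_nonneg h

theorem le_wt {t : WTree} {m : ℝ} (hm : 0 ≤ m) (h : ∀ x ∈ t.leaves, m ≤ x) : m ≤ t.wt := by
  obtain ⟨x, hx⟩ := List.exists_mem_of_ne_nil _ t.leaves_ne_nil
  exact (h x hx).trans (List.single_le_sum (fun y hy => hm.trans (h y hy)) x hx)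

theorem IsOAT.left {l r : WTree} (h : (node l r).IsOAT) : l.IsOAT := by
  intro t ht
  have hc := h (node t r) (by simp [leaves, ht])
  have hwt : t.wt = l.wt := by simp [wt, ht]
  simp only [cost] at hc
  linarith

theorem IsOAT.right {l r : WTree} (h : (node l r).IsOAT) : r.IsOAT := by
  intro t ht
  have hc := h (node l t) (by simp [leaves, ht])
  have hwt : t.wt = r.wt := by simp [wt, ht]
  simp only [cost] at hc
  linarith

theorem IsOAT.wt_left_left_le {a b c : WTree} (h : (node (node a b) c).IsOAT) :
    a.wt ≤ c.wt := by
  have hc := h (node a (node b c)) (by simp [leaves])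
  simp only [cost, wt_node] at hc
  linarith

theorem IsOAT.wt_right_right_le {a b c : WTree} (h : (node c (node b a)).IsOAT) :
    a.wt ≤ c.wt := by
  have hc := h (node (node c b) a) (by simp [leaves])
  simp only [cost, wt_node] at hc
  linarith

theorem IsOAT.wt_left_right_le {a b c : WTree} (h : (node (node a b) c).IsOAT)
    (hb : 0 < b.height) : b.wt ≤ c.wt := by
  cases b with
  | leaf x => simp [height] at hb
  | node x y =>
    have hc := h (node (node a x) (node y c)) (by simp [leaves])
    simp only [cost, wt_node] at hc ⊢
    linarith

theorem IsOAT.wt_right_left_le {a b c : WTree} (h : (node c (node b a)).IsOAT)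
    (hb : 0 < b.height) : b.wt ≤ c.wt := by
  cases b with
  | leaf x => simp [height] at hb
  | node x y =>
    have hc := h (node (node c x) (node y a)) (by simp [leaves])
    simp only [cost, wt_node] at hc ⊢
    linarith

/-- An optimal alphabetic tree of height at least three has an optimal subtree two levels
below the root, on a longest path, with at most half of the total weight. -/
theorem IsOAT.exists_half {t : WTree} (h : t.IsOAT) (hw : ∀ x ∈ t.leaves, 0 ≤ x)
    (ht : 3 ≤ t.height) :
    ∃ s : WTree, s.IsOAT ∧ s.leaves ⊆ t.leaves ∧ s.height + 2 = t.height ∧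
      2 * s.wt ≤ t.wt := by
  cases t with
  | leaf x => simp [height] at ht
  | node l r =>
    rcases le_total r.height l.height with hlr | hlr
    · cases l with
      | leaf x => simp [height] at ht hlr; omega
      | node a b =>
        have ha : 0 ≤ a.wt := wt_nonneg fun x hx => hw x (by simp [leaves, hx])
        have hb : 0 ≤ b.wt := wt_nonneg fun x hx => hw x (by simp [leaves, hx])
        simp only [height] at ht hlr
        rcases le_total b.height a.height with hab | hab
        · refine ⟨a, h.left.left, fun x hx => by simp [leaves, hx], ?_, ?_⟩
          · simp only [height]; omega
          · have := h.wt_left_left_le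
            simp only [wt_node]; linarith
        · refine ⟨b, h.left.right, fun x hx => by simp [leaves, hx], ?_, ?_⟩
          · simp only [height]; omega
          · have := h.wt_left_right_le (by omega)
            simp only [wt_node]; linarith
    · cases r with
      | leaf x => simp [height] at ht hlr; omega
      | node b a =>
        have ha : 0 ≤ a.wt := wt_nonneg fun x hx => hw x (by simp [leaves, hx])
        have hb : 0 ≤ b.wt := wt_nonneg fun x hx => hw x (by simp [leaves, hx])
        simp only [height] at ht hlr
        rcases le_total b.height a.height with hab | hab
        · refine ⟨a, h.right.right, fun x hx => by simp [leaves, hx], ?_, ?_⟩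
          · simp only [height]; omega
          · have := h.wt_right_right_le
            simp only [wt_node]; linarith
        · refine ⟨b, h.right.left, fun x hx => by simp [leaves, hx], ?_, ?_⟩
          · simp only [height]; omega
          · have := h.wt_right_left_le (by omega)
            simp only [wt_node]; linarith

theorem IsOAT.mul_two_pow_le_wt {m : ℝ} (hm : 0 ≤ m) (t : WTree) (h : t.IsOAT)
    (hw : ∀ x ∈ t.leaves, m ≤ x) : m * 2 ^ (t.height / 3) ≤ t.wt := by
  induction hn : t.height using Nat.strong_induction_on generalizing t with
  | _ n ih =>
    subst hn
    by_cases ht : 3 ≤ t.height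
    · obtain ⟨s, hs, hsub, hh, hwt⟩ := h.exists_half (fun x hx => hm.trans (hw x hx)) ht
      have hle := ih s.height (by omega) s hs (fun x hx => hw x (hsub hx)) rfl
      calc m * 2 ^ (t.height / 3) ≤ m * 2 ^ (s.height / 3 + 1) := by
            gcongr
            · norm_num
            · omega
        _ = 2 * (m * 2 ^ (s.height / 3)) := by ring
        _ ≤ t.wt := by linarith
    · rw [Nat.div_eq_of_lt (by omega), pow_zero, mul_one]
      exact le_wt hm hw

end WTree

/-- **Height bound for optimal alphabetic trees.**
If `T` is an optimal alphabetic tree all of whose leaf weights are at least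
`m > 0`, and `h` is its height, then `m·2^⌊h/3⌋ ≤ Σᵢ aᵢ`.  In particular,
when all weights are at least `1` (e.g. positive integers),
`2^⌊h/3⌋ ≤ Σᵢ aᵢ`. -/
theorem oat_height_bound (T : WTree) (m : ℝ) (hm : 0 < m)
    (hw : ∀ x ∈ T.leaves, m ≤ x) (hopt : T.IsOAT) :
    m * 2 ^ (T.height / 3) ≤ T.leaves.sum ∧
    ((1 : ℝ) ≤ m → (2 : ℝ) ^ (T.height / 3) ≤ T.leaves.sum) := by
  have h := WTree.IsOAT.mul_two_pow_le_wt hm.le T hopt hw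
  exact ⟨h, fun h1 => (le_mul_of_one_le_left (by positivity) h1).trans h⟩
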